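/- For every z > 0 one has f(z⁻¹) = M − f(z). Consequently, for every α ∈ (0, M), if z > 0 satisfies f(z) = α, then z⁻¹ is the unique positive solution of f(w) = M − α; that is, f⁻¹(M − α) = 1 / f⁻¹(α). -/

import Mathlib

open Finset Filter Real Topology

/-- The local weight enumerating polynomial `A_t(z) = 1 + ∑_{u=r_t}^{s_t} a_{t,u} z^u`,
encoded with a full coefficient function `a` satisfying `a t 0 = 1`, `a t u = 0` for
`0 < u < r t` and for `u > s t`. -/
noncomputable def Afun {ι : Type*} (s : ι → ℕ) (a : ι → ℕ → ℝ) (t : ι) (z : ℝ) : ℝ :=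
  ∑ u ∈ Finset.range (s t + 1), a t u * z ^ u

/-- The function `f(z) = c ⬝ ∑_{t ∈ I_c} γ_t z A_t′(z) / A_t(z)`. -/
noncomputable def ff {ι : Type*} [Fintype ι] (s : ι → ℕ) (a : ι → ℕ → ℝ)
    (γ : ι → ℝ) (c : ℝ) (z : ℝ) : ℝ :=
  c * ∑ t, γ t * (z * deriv (Afun s a t) z) / Afun s a t z

theorem sum_range_mul_inv_pow_eq {n : ℕ} {p : ℕ → ℝ} (hp : ∀ u ≤ n, p u = p (n - u))
    {z : ℝ} (hz : z ≠ 0) :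
    (∑ u ∈ Finset.range (n + 1), p u * z⁻¹ ^ u) * z ^ n =
      ∑ u ∈ Finset.range (n + 1), p u * z ^ u := by
  rw [← Finset.sum_range_reflect (fun u => p u * z ^ u), Finset.sum_mul]
  refine Finset.sum_congr rfl fun u hu => ?_
  have hu : u ≤ n := Nat.lt_succ_iff.mp (Finset.mem_range.mp hu)
  rw [Nat.add_sub_cancel, ← hp u hu, pow_sub₀ z hz hu, inv_pow]
  ring

theorem sum_range_natCast_mul_inv_pow_eq {n : ℕ} {p : ℕ → ℝ}
    (hp : ∀ u ≤ n, p u = p (n - u)) {z : ℝ} (hz : z ≠ 0) :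
    (∑ u ∈ Finset.range (n + 1), (u : ℝ) * p u * z⁻¹ ^ u) * z ^ n =
      n * (∑ u ∈ Finset.range (n + 1), p u * z ^ u) -
        ∑ u ∈ Finset.range (n + 1), (u : ℝ) * p u * z ^ u := by
  rw [Finset.mul_sum, ← Finset.sum_sub_distrib,
    ← Finset.sum_range_reflect (fun u => (n : ℝ) * (p u * z ^ u) - (u : ℝ) * p u * z ^ u),
    Finset.sum_mul]
  refine Finset.sum_congr rfl fun u hu => ?_
  have hu : u ≤ n := Nat.lt_succ_iff.mp (Finset.mem_range.mp hu)
  rw [Nat.add_sub_cancel, ← hp u hu, pow_sub₀ z hz hu, inv_pow, Nat.cast_sub hu]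
  ring

theorem natCast_sub_mul_pow_mul_pow_sub_nonneg {x y : ℝ} (hx : 0 ≤ x) (hxy : x ≤ y) (u v : ℕ) :
    0 ≤ ((u : ℝ) - v) * (y ^ u * x ^ v - y ^ v * x ^ u) := by
  have key : ∀ v k : ℕ, 0 ≤ (k : ℝ) * ((x * y) ^ v * (y ^ k - x ^ k)) := fun v k =>
    mul_nonneg k.cast_nonneg (mul_nonneg (pow_nonneg (mul_nonneg hx (hx.trans hxy)) v)
      (sub_nonneg.mpr (pow_le_pow_left₀ hx hxy k)))
  rcases le_total v u with h | h
  · obtain ⟨k, rfl⟩ := Nat.exists_eq_add_of_le h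
    convert key v k using 1
    push_cast
    ring
  · obtain ⟨k, rfl⟩ := Nat.exists_eq_add_of_le h
    convert key u k using 1
    push_cast
    ring

theorem sum_natCast_mul_pow_mul_sum_lt {S : Finset ℕ} {p : ℕ → ℝ} (hp : ∀ u, 0 ≤ p u)
    (h0 : 0 ∈ S) (hp0 : 0 < p 0) {m : ℕ} (hm : m ∈ S) (hm0 : m ≠ 0) (hpm : 0 < p m)
    {x y : ℝ} (hx : 0 ≤ x) (hxy : x < y) :
    (∑ u ∈ S, (u : ℝ) * p u * x ^ u) * (∑ u ∈ S, p u * y ^ u) <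
      (∑ u ∈ S, (u : ℝ) * p u * y ^ u) * (∑ u ∈ S, p u * x ^ u) := by
  have hnonneg : ∀ u v : ℕ,
      0 ≤ p u * p v * (((u : ℝ) - v) * (y ^ u * x ^ v - y ^ v * x ^ u)) := fun u v =>
    mul_nonneg (mul_nonneg (hp u) (hp v))
      (natCast_sub_mul_pow_mul_pow_sub_nonneg hx hxy.le u v)
  have hpos : 0 < ∑ u ∈ S, ∑ v ∈ S,
      p u * p v * (((u : ℝ) - v) * (y ^ u * x ^ v - y ^ v * x ^ u)) := by
    refine Finset.sum_pos' (fun u _ => Finset.sum_nonneg fun v _ => hnonneg u v)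
      ⟨m, hm, Finset.sum_pos' (fun v _ => hnonneg m v) ⟨0, h0, ?_⟩⟩
    have h1 : 0 < y ^ m - x ^ m := sub_pos.mpr (pow_lt_pow_left₀ hxy hx hm0)
    have h2 : (0 : ℝ) < m := Nat.cast_pos.mpr (Nat.pos_of_ne_zero hm0)
    simpa using mul_pos (mul_pos hpm hp0) (mul_pos h2 h1)
  have hsplit : ∑ u ∈ S, ∑ v ∈ S,
      p u * p v * (((u : ℝ) - v) * (y ^ u * x ^ v - y ^ v * x ^ u)) =
      2 * ((∑ u ∈ S, (u : ℝ) * p u * y ^ u) * (∑ u ∈ S, p u * x ^ u) -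
        (∑ u ∈ S, (u : ℝ) * p u * x ^ u) * (∑ u ∈ S, p u * y ^ u)) := by
    have e : ∀ u v : ℕ, p u * p v * (((u : ℝ) - v) * (y ^ u * x ^ v - y ^ v * x ^ u)) =
        ((u : ℝ) * p u * y ^ u) * (p v * x ^ v) - ((u : ℝ) * p u * x ^ u) * (p v * y ^ v)
        + ((p u * x ^ u) * ((v : ℝ) * p v * y ^ v)
          - (p u * y ^ u) * ((v : ℝ) * p v * x ^ v)) := fun u v => by ring
    simp only [e, Finset.sum_add_distrib, Finset.sum_sub_distrib, ← Finset.sum_mul_sum]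
    ring
  linarith

theorem mul_deriv_Afun {ι : Type*} (s : ι → ℕ) (a : ι → ℕ → ℝ) (t : ι) (z : ℝ) :
    z * deriv (Afun s a t) z = ∑ u ∈ Finset.range (s t + 1), (u : ℝ) * a t u * z ^ u := by
  have h : HasDerivAt (Afun s a t)
      (∑ u ∈ Finset.range (s t + 1), a t u * ((u : ℝ) * z ^ (u - 1))) z :=
    HasDerivAt.fun_sum fun u _ => (hasDerivAt_pow u z).const_mul (a t u)
  rw [h.deriv, Finset.mul_sum]
  refine Finset.sum_congr rfl fun u _ => ?_
  cases u with
  | zero => simp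
  | succ k =>
    rw [Nat.add_sub_cancel]
    ring

theorem Afun_pos {ι : Type*} {s : ι → ℕ} {a : ι → ℕ → ℝ} {t : ι} (ha0 : 0 < a t 0)
    (hnn : ∀ u, 0 ≤ a t u) {z : ℝ} (hz : 0 ≤ z) : 0 < Afun s a t z :=
  Finset.sum_pos' (fun u _ => mul_nonneg (hnn u) (pow_nonneg hz u))
    ⟨0, by simp, by simpa using ha0⟩

theorem inv_mul_deriv_Afun_inv_div {ι : Type*} {s : ι → ℕ} {a : ι → ℕ → ℝ} {t : ι}
    (ha0 : 0 < a t 0) (hnn : ∀ u, 0 ≤ a t u) (hsym : ∀ u ≤ s t, a t u = a t (s t - u))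
    {z : ℝ} (hz : 0 < z) :
    z⁻¹ * deriv (Afun s a t) z⁻¹ / Afun s a t z⁻¹ =
      s t - z * deriv (Afun s a t) z / Afun s a t z := by
  have hA := Afun_pos (s := s) ha0 hnn hz.le
  have hzn : z ^ s t ≠ 0 := (pow_pos hz _).ne'
  have h1 : Afun s a t z⁻¹ * z ^ s t = Afun s a t z := sum_range_mul_inv_pow_eq hsym hz.ne'
  have h2 : z⁻¹ * deriv (Afun s a t) z⁻¹ * z ^ s t =
      s t * Afun s a t z - z * deriv (Afun s a t) z := by
    rw [mul_deriv_Afun, mul_deriv_Afun]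
    exact sum_range_natCast_mul_inv_pow_eq hsym hz.ne'
  rw [← mul_div_mul_right _ _ hzn, h1, h2, sub_div, mul_div_cancel_right₀ _ hA.ne']

theorem strictMonoOn_mul_deriv_Afun_div {ι : Type*} {s : ι → ℕ} {a : ι → ℕ → ℝ} {t : ι}
    (ha0 : 0 < a t 0) (hnn : ∀ u, 0 ≤ a t u) {m : ℕ} (hm0 : m ≠ 0) (hms : m ≤ s t)
    (ham : 0 < a t m) :
    StrictMonoOn (fun z => z * deriv (Afun s a t) z / Afun s a t z) (Set.Ici 0) := by
  intro x hx y hy hxy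
  have hx : 0 ≤ x := hx
  have hy : 0 ≤ y := hy
  beta_reduce
  rw [div_lt_div_iff₀ (Afun_pos ha0 hnn hx) (Afun_pos ha0 hnn hy),
    mul_deriv_Afun, mul_deriv_Afun]
  exact sum_natCast_mul_pow_mul_sum_lt hnn (by simp) ha0
    (Finset.mem_range.mpr (Nat.lt_succ_of_le hms)) hm0 ham hx hxy

/-- if each `A_t` has symmetric coefficients (so `ū_t = s_t` and
`M = c ⬝ ∑_t γ_t s_t`), then `f(z⁻¹) = M − f(z)` for all `z > 0`; consequently, for every
`α ∈ (0,M)`, if `f(z) = α` with `z > 0`, then `z⁻¹` is the unique positive solution of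
`f(w) = M − α`, i.e. `f⁻¹(M−α) = 1/f⁻¹(α)`. -/
theorem stmt_7 {ι : Type*} [Fintype ι] [Nonempty ι]
    (r s : ι → ℕ) (h2r : ∀ t, 2 ≤ r t) (hrs : ∀ t, r t ≤ s t)
    (a : ι → ℕ → ℝ)
    (ha0 : ∀ t, a t 0 = 1)
    (hmid : ∀ t u, 0 < u → u < r t → a t u = 0)
    (hhigh : ∀ t u, s t < u → a t u = 0)
    (hnn : ∀ t u, 0 ≤ a t u)
    (har : ∀ t, 0 < a t (r t))
    (hsym : ∀ t, ∀ u ≤ s t, a t u = a t (s t - u))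
    (γ : ι → ℝ) (hγ : ∀ t, 0 < γ t) (c : ℝ) (hc : 0 < c) :
    (∀ z : ℝ, 0 < z →
        ff s a γ c z⁻¹ = (c * ∑ t, γ t * (s t : ℝ)) - ff s a γ c z) ∧
    (∀ α : ℝ, 0 < α → α < c * ∑ t, γ t * (s t : ℝ) →
      ∀ z : ℝ, 0 < z → ff s a γ c z = α →
        ff s a γ c z⁻¹ = (c * ∑ t, γ t * (s t : ℝ)) - α ∧
        ∀ w : ℝ, 0 < w → ff s a γ c w = (c * ∑ t, γ t * (s t : ℝ)) - α → w = z⁻¹) := by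
  have hpos : ∀ t, 0 < a t 0 := fun t => (ha0 t).symm ▸ one_pos
  have hinv : ∀ z : ℝ, 0 < z →
      ff s a γ c z⁻¹ = (c * ∑ t, γ t * (s t : ℝ)) - ff s a γ c z := by
    intro z hz
    simp only [ff, mul_div_assoc (γ _)]
    rw [← mul_sub, ← Finset.sum_sub_distrib]
    congr 1
    refine Finset.sum_congr rfl fun t _ => ?_
    rw [inv_mul_deriv_Afun_inv_div (hpos t) (hnn t) (hsym t) hz, mul_sub]
  have hmono : StrictMonoOn (ff s a γ c) (Set.Ioi 0) := by
    intro x hx y hy hxy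
    simp only [ff, mul_div_assoc (γ _)]
    refine mul_lt_mul_of_pos_left (Finset.sum_lt_sum_of_nonempty Finset.univ_nonempty
      fun t _ => mul_lt_mul_of_pos_left ?_ (hγ t)) hc
    have hr : r t ≠ 0 := by have := h2r t; omega
    exact strictMonoOn_mul_deriv_Afun_div (hpos t) (hnn t) hr (hrs t) (har t)
      (Set.Ioi_subset_Ici_self hx) (Set.Ioi_subset_Ici_self hy) hxy
  refine ⟨hinv, fun α _ _ z hz hfz => ?_⟩
  have hz' := hfz ▸ hinv z hz
  exact ⟨hz', fun w hw hfw =>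
    hmono.injOn (Set.mem_Ioi.mpr hw) (Set.mem_Ioi.mpr (inv_pos.mpr hz)) (hfw.trans hz'.symm)⟩
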